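/- arXiv:q-bio/0404021 — 2 statements merged into one kernel-verified Lean document; each statement's English description precedes it below -/
import Mathlib

section
/- (Theorem 1, core statement.) Suppose I < 101/10, so that the fixed point lies strictly below the threshold (Im z⋆ = 10I/101 < 1). Let z₀ ∈ ℂ and z(t) = z⋆ + (z₀ - z⋆)·exp((-1 + 10i)t). If Im z(t) < 1 for all t ∈ [0, π/5] (one full 360-degree rotation around the fixed point), then Im z(t) < 1 for all t ≥ 0; that is, an orbit that does not reach the threshold within one full rotation never reaches it. -/
open Real

/-- Theorem 1, core statement: Suppose `I < 101/10`, so that the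
fixed point lies strictly below the threshold. If the orbit
`z(t) = z⋆ + (z₀ - z⋆) · exp((-1 + 10i) t)` satisfies `Im z(t) < 1` for all
`t ∈ [0, π/5]` (one full rotation around the fixed point), then
`Im z(t) < 1` for all `t ≥ 0`: an orbit that does not reach the threshold
within one full rotation never reaches it. -/
theorem resonate_and_fire_no_fire_after_full_rotation (I : ℝ) (z₀ : ℂ)
    (hI : I < 101 / 10) :
    let zstar : ℂ := (I : ℂ) / 101 + (10 * (I : ℂ) / 101) * Complex.I
    let z : ℝ → ℂ := fun t => zstar + (z₀ - zstar) * Complex.exp ((-1 + 10 * Complex.I) * t)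
    (∀ t ∈ Set.Icc (0 : ℝ) (π / 5), (z t).im < 1) →
      ∀ t : ℝ, 0 ≤ t → (z t).im < 1 := by
  intro zstar z h t ht
  have hp : (0 : ℝ) < π / 5 := by positivity
  obtain ⟨n, hn⟩ : ∃ n : ℕ, n = ⌊t / (π / 5)⌋₊ := ⟨_, rfl⟩
  have h1 : (n : ℝ) * (π / 5) ≤ t := by
    rw [← le_div_iff₀ hp, hn]
    exact Nat.floor_le (by positivity)
  have h2 : t < ((n : ℝ) + 1) * (π / 5) := by
    rw [← div_lt_iff₀ hp, hn]
    exact Nat.lt_floor_add_one _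
  have h3 := h (t - n * (π / 5)) ⟨by linarith, by linarith⟩
  have hc : zstar.im < 1 := by
    have : zstar = ((I / 101 : ℝ) : ℂ) + ((10 * I / 101 : ℝ) : ℂ) * Complex.I := by
      simp only [zstar]; push_cast; ring
    rw [this]
    simp only [Complex.add_im, Complex.ofReal_im, Complex.re_ofReal_mul, Complex.im_ofReal_mul,
      Complex.I_im]
    linarith
  have he : Complex.exp ((-1 + 10 * Complex.I) * t) =
      ((Real.exp (-(n * (π / 5))) : ℝ) : ℂ) *
        Complex.exp ((-1 + 10 * Complex.I) * ((t - n * (π / 5) : ℝ) : ℂ)) := by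
    rw [Complex.ofReal_exp, ← Complex.exp_add, Complex.exp_eq_exp_iff_exists_int]
    refine ⟨n, ?_⟩
    push_cast
    ring
  have hr0 : 0 < Real.exp (-(n * (π / 5))) := Real.exp_pos _
  have hr1 : Real.exp (-(n * (π / 5))) ≤ 1 := Real.exp_le_one_iff.mpr (by
    have : 0 ≤ (n : ℝ) * (π / 5) := by positivity
    linarith)
  simp only [z] at h3 ⊢
  rw [he, mul_left_comm, Complex.add_im, Complex.im_ofReal_mul]
  rw [Complex.add_im] at h3
  nlinarith [mul_pos hr0 (sub_pos.mpr h3), mul_nonneg (sub_nonneg.mpr hr1) (sub_pos.mpr hc).le]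
end

section
/- Define f : ℝ × ℝ → ℝ by f(T, T') = Im(z⋆ + ((-i - z⋆)·exp((-1 + 10i)T) + K)·exp((-1 + 10i)T')), where z⋆ = I/101 + (10I/101)i and I, K ∈ ℝ are parameters. Then the partial derivatives of f satisfy, for all (T, T'), the identity ∂f/∂T'(T, T') - ∂f/∂T(T, T') = K·e^{-T'}·(10·cos(10T') - sin(10T')). -/
/-- The value of `y` at time `T + T'` for the orbit of the resonate-and-fire
model that is reset to `z = -i` at time `0` and receives a pulse of strength
`K` (added to the `x`-coordinate) at time `T`, with fixed point
`z⋆ = I/101 + (10I/101) i`. -/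
noncomputable def rfFiringMapF (I K : ℝ) (T T' : ℝ) : ℝ :=
  (((I : ℂ) / 101 + (10 * (I : ℂ) / 101) * Complex.I) +
    ((-Complex.I - ((I : ℂ) / 101 + (10 * (I : ℂ) / 101) * Complex.I)) *
        Complex.exp ((-1 + 10 * Complex.I) * T) + (K : ℂ)) *
      Complex.exp ((-1 + 10 * Complex.I) * T')).im

theorem rf_exp_deriv (t : ℝ) : HasDerivAt (fun s : ℝ => Complex.exp ((-1 + 10 * Complex.I) * s))
    (Complex.exp ((-1 + 10 * Complex.I) * t) * (-1 + 10 * Complex.I)) t := by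
  have h := ((Complex.ofRealCLM.hasDerivAt (x := t)).const_mul (-1 + 10 * Complex.I)).cexp
  simpa using h

theorem rf_im_deriv {g : ℝ → ℂ} {g' : ℂ} {t : ℝ} (h : HasDerivAt g g' t) :
    HasDerivAt (fun s => (g s).im) g'.im t :=
  Complex.imCLM.hasFDerivAt.comp_hasDerivAt t h

theorem rf_exp_eq (t : ℝ) : Complex.exp ((-1 + 10 * Complex.I) * t) =
    (Real.exp (-t) : ℂ) * ((Real.cos (10 * t) : ℂ) + (Real.sin (10 * t) : ℂ) * Complex.I) := by
  push_cast
  rw [← Complex.exp_mul_I, ← Complex.exp_add]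
  congr 1
  ring

/-- The partial derivatives of
`f(T, T') = Im(z⋆ + ((-i - z⋆) exp((-1 + 10i) T) + K) exp((-1 + 10i) T'))`
satisfy, for all `(T, T')`,
`∂f/∂T'(T, T') - ∂f/∂T(T, T') = K e^{-T'} (10 cos 10T' - sin 10T')`. -/
theorem rfFiringMapF_partial_deriv_difference (I K : ℝ) (T T' : ℝ) :
    deriv (fun s => rfFiringMapF I K T s) T' - deriv (fun s => rfFiringMapF I K s T') T =
      K * Real.exp (-T') * (10 * Real.cos (10 * T') - Real.sin (10 * T')) := by
  unfold rfFiringMapF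
  rw [(rf_im_deriv (((rf_exp_deriv T').const_mul _).const_add _)).deriv,
    (rf_im_deriv (((((rf_exp_deriv T).const_mul _).add_const _).mul_const _).const_add _)).deriv,
    ← Complex.sub_im]
  have e : ∀ a E F c k : ℂ, (a * E + k) * (F * c) - a * (E * c) * F = k * (F * c) := by
    intros; ring
  rw [e, rf_exp_eq, Complex.im_ofReal_mul, mul_assoc (Real.exp (-T') : ℂ),
    Complex.im_ofReal_mul, mul_assoc]
  congr 2
  simp only [Complex.mul_im, Complex.add_re, Complex.add_im, Complex.ofReal_re, Complex.ofReal_im,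
    Complex.mul_re, Complex.I_re, Complex.I_im, Complex.neg_re, Complex.neg_im, Complex.one_re,
    Complex.one_im, Complex.re_ofNat, Complex.im_ofNat]
  ring
end
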